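/- Let k ≥ 2, M ≥ 2, N ≥ 1 be integers, let σ > 0, c̄ > 0, z̄ > 0, and set α = c̄·σ²/N. Let Ỹ_1,…,Ỹ_M ∈ ℝ, let y : [0,1] → ℝ be k times continuously differentiable with |y'(x)| ≤ Q for all x ∈ [0,1], and suppose Δ_M² ≤ z̄·σ²/N. Let f_* : [0,1] → ℝ be k times continuously differentiable with f_*(0) = y(0), f_*(1) = y(1), and Φ(f_*) ≤ Φ(y). Set e = f_* − y. Then ‖e^{(k)}‖ ≤ sqrt(2·z̄/c̄ + 2·Q²·h_M²/(c̄·N·σ²)) + 2·‖y^{(k)}‖, and ‖e‖ ≤ h_M·‖e'‖ + sqrt((8·z̄·σ² + 2·c̄·σ²·‖y^{(k)}‖²)/N + 8·Q²·h_M²/N²). -/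

import Mathlib

open MeasureTheory Set

/-- The average of `f` over the `i`-th subinterval `[(i-1)/M, i/M]`. -/
noncomputable def intervalAvg (M : ℕ) (f : ℝ → ℝ) (i : ℕ) : ℝ :=
  (M : ℝ) * ∫ x in (((i : ℝ) - 1) / M)..((i : ℝ) / M), f x

/-- The Tikhonov functional `Φ`. -/
noncomputable def tikhonov (M k : ℕ) (α : ℝ) (Ytil : ℕ → ℝ) (f : ℝ → ℝ) : ℝ :=
  (1 / M) * ∑ i ∈ Finset.Icc 1 M, (Ytil i - intervalAvg M f i) ^ 2
    + α * ∫ x in (0:ℝ)..1, (iteratedDerivWithin k f (Icc 0 1) x) ^ 2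

/-- The exact group means `Y_i = (1/N) ∑_{j=(i−1)N+1}^{iN} y(ĵ/(MN))`. -/
noncomputable def groupMean (M N : ℕ) (y : ℝ → ℝ) (i : ℕ) : ℝ :=
  (1 / N) * ∑ j ∈ Finset.Icc ((i - 1) * N + 1) (i * N), y ((j : ℝ) / (M * N))

/-- The statistic `Δ_M² = (1/M) ∑_{i=1}^M (Ỹ_i − Y_i)²`. -/
noncomputable def deltaSq (M N : ℕ) (Ytil : ℕ → ℝ) (y : ℝ → ℝ) : ℝ :=
  (1 / M) * ∑ i ∈ Finset.Icc 1 M, (Ytil i - groupMean M N y i) ^ 2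

/-- The `L²(0,1)` norm. -/
noncomputable def l2norm (g : ℝ → ℝ) : ℝ :=
  Real.sqrt (∫ x in (0:ℝ)..1, g x ^ 2)

section

open intervalIntegral

lemma integral_sub_const_sq {a b : ℝ} (hab : a ≤ b) {g : ℝ → ℝ}
    (hg : ContinuousOn g (Icc a b)) (c : ℝ) :
    ∫ x in a..b, (g x - c) ^ 2
      = (∫ x in a..b, g x ^ 2) - 2 * c * (∫ x in a..b, g x) + c ^ 2 * (b - a) := by
  rw [← uIcc_of_le hab] at hg
  have h1 : IntervalIntegrable (fun x => g x ^ 2) volume a b := (hg.pow 2).intervalIntegrable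
  have h2 : IntervalIntegrable (fun x => 2 * c * g x) volume a b :=
    (hg.const_mul (2 * c)).intervalIntegrable
  have h3 : ∀ x, (g x - c) ^ 2 = g x ^ 2 - 2 * c * g x + c ^ 2 := fun x => by ring
  simp_rw [h3]
  rw [integral_add (h1.sub h2) intervalIntegrable_const, integral_sub h1 h2,
    intervalIntegral.integral_const_mul, intervalIntegral.integral_const, smul_eq_mul]
  ring

lemma sq_integral_le {a b : ℝ} (hab : a ≤ b) {g : ℝ → ℝ} (hg : ContinuousOn g (Icc a b)) :
    (∫ x in a..b, g x) ^ 2 ≤ (b - a) * ∫ x in a..b, g x ^ 2 := by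
  rcases hab.eq_or_lt with rfl | hlt
  · simp
  have hL : 0 < b - a := sub_pos.2 hlt
  have h0 : 0 ≤ ∫ x in a..b, (g x - (∫ x in a..b, g x) / (b - a)) ^ 2 :=
    integral_nonneg hab fun x _ => sq_nonneg _
  rw [integral_sub_const_sq hab hg] at h0
  have h1 := mul_nonneg hL.le h0
  field_simp at h1
  linarith

/-- A Poincaré inequality with constant `b - a` on `[a, b]`. -/
lemma integral_sq_le_deriv_add_mean {a b : ℝ} (hab : a < b) {e g : ℝ → ℝ}
    (he : ContinuousOn e (Icc a b)) (hg : ContinuousOn g (Icc a b))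
    (hd : ∀ x ∈ Ioo a b, HasDerivAt e (g x) x) :
    ∫ x in a..b, e x ^ 2
      ≤ (b - a) ^ 2 * (∫ x in a..b, g x ^ 2) + (∫ x in a..b, e x) ^ 2 / (b - a) := by
  have hL : 0 < b - a := sub_pos.2 hab
  have hg2 : IntervalIntegrable (fun x => g x ^ 2) volume a b :=
    ((uIcc_of_le hab.le ▸ hg).pow 2).intervalIntegrable
  have key : ∀ x ∈ Icc a b, (e x - e a) ^ 2 ≤ (b - a) * ∫ t in a..b, g t ^ 2 := by
    intro x hx
    have hsub : Icc a x ⊆ Icc a b := Icc_subset_Icc_right hx.2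
    have hgx := hg.mono hsub
    rw [← integral_eq_sub_of_hasDerivAt_of_le hx.1 (he.mono hsub)
      (fun t ht => hd t ⟨ht.1, ht.2.trans_le hx.2⟩)
      (uIcc_of_le hx.1 ▸ hgx).intervalIntegrable]
    have hmono : ∫ t in a..x, g t ^ 2 ≤ ∫ t in a..b, g t ^ 2 :=
      integral_mono_interval le_rfl hx.1 hx.2 (ae_of_all _ fun t => sq_nonneg _) hg2
    have h0 : 0 ≤ ∫ t in a..b, g t ^ 2 := integral_nonneg hab.le fun t _ => sq_nonneg _
    calc _ ≤ (x - a) * ∫ t in a..x, g t ^ 2 := sq_integral_le hx.1 hgx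
      _ ≤ (x - a) * ∫ t in a..b, g t ^ 2 := by gcongr; exact sub_nonneg.2 hx.1
      _ ≤ _ := by gcongr; exact hx.2
  have hI : ∫ x in a..b, (e x - e a) ^ 2 ≤ ∫ _ in a..b, (b - a) * ∫ t in a..b, g t ^ 2 :=
    integral_mono_on hab.le
      ((((uIcc_of_le hab.le).symm ▸ he).sub continuousOn_const).pow 2).intervalIntegrable
      intervalIntegrable_const key
  rw [integral_sub_const_sq hab.le he, intervalIntegral.integral_const, smul_eq_mul] at hI
  have hquad : 2 * e a * (∫ x in a..b, e x) - e a ^ 2 * (b - a)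
      ≤ (∫ x in a..b, e x) ^ 2 / (b - a) := by
    rw [le_div_iff₀ hL]
    nlinarith [sq_nonneg ((∫ x in a..b, e x) - e a * (b - a))]
  nlinarith

lemma l2norm_sq (g : ℝ → ℝ) : l2norm g ^ 2 = ∫ x in (0:ℝ)..1, g x ^ 2 :=
  Real.sq_sqrt (integral_nonneg zero_le_one fun _ _ => sq_nonneg _)

lemma l2norm_nonneg (g : ℝ → ℝ) : 0 ≤ l2norm g := Real.sqrt_nonneg _

lemma l2norm_congr {f g : ℝ → ℝ} (h : EqOn f g (Icc 0 1)) : l2norm f = l2norm g := by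
  unfold l2norm
  congr 1
  refine integral_congr fun x hx => ?_
  rw [uIcc_of_le zero_le_one] at hx
  simp only [h hx]

lemma l2norm_sub_le {f g : ℝ → ℝ} (hf : ContinuousOn f (Icc 0 1))
    (hg : ContinuousOn g (Icc 0 1)) :
    l2norm (fun x => f x - g x) ≤ l2norm f + l2norm g := by
  have hf' := hf
  have hg' := hg
  rw [← uIcc_of_le zero_le_one] at hf' hg'
  have i1 : IntervalIntegrable (fun x => f x ^ 2) volume 0 1 := (hf'.pow 2).intervalIntegrable
  have i2 : IntervalIntegrable (fun x => g x ^ 2) volume 0 1 := (hg'.pow 2).intervalIntegrable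
  have i3 : IntervalIntegrable (fun x => f x * g x) volume 0 1 := (hf'.mul hg').intervalIntegrable
  have expand : ∀ t : ℝ, ∫ x in (0:ℝ)..1, (f x - t * g x) ^ 2
      = l2norm f ^ 2 - 2 * t * (∫ x in (0:ℝ)..1, f x * g x) + t ^ 2 * l2norm g ^ 2 := by
    intro t
    have h3 : ∀ x, (f x - t * g x) ^ 2 = f x ^ 2 - 2 * t * (f x * g x) + t ^ 2 * g x ^ 2 :=
      fun x => by ring
    simp_rw [h3]
    rw [integral_add (i1.sub (i3.const_mul _)) (i2.const_mul _),
      integral_sub i1 (i3.const_mul _), intervalIntegral.integral_const_mul,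
      intervalIntegral.integral_const_mul, l2norm_sq, l2norm_sq]
  have hcs : (∫ x in (0:ℝ)..1, f x * g x) ^ 2 ≤ (l2norm f * l2norm g) ^ 2 := by
    have := discrim_le_zero (a := l2norm g ^ 2) (b := -2 * ∫ x in (0:ℝ)..1, f x * g x)
      (c := l2norm f ^ 2) fun t => by
        have h0 : 0 ≤ ∫ x in (0:ℝ)..1, (f x - t * g x) ^ 2 :=
          integral_nonneg zero_le_one fun x _ => sq_nonneg _
        rw [expand t] at h0
        linarith
    unfold discrim at this
    linarith
  have hF := l2norm_nonneg f
  have hG := l2norm_nonneg g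
  have hcs' := abs_le_of_sq_le_sq' hcs (mul_nonneg hF hG)
  refine abs_le_of_sq_le_sq (?_) (add_nonneg hF hG) |> (le_abs_self _).trans
  have h1 := expand 1
  simp only [one_mul] at h1
  rw [l2norm_sq, h1]
  linarith [hcs'.1]

lemma sum_Icc_one_eq_sum_range (M : ℕ) (F : ℕ → ℝ) :
    ∑ i ∈ Finset.Icc 1 M, F i = ∑ p ∈ Finset.range M, F (p + 1) := by
  rw [Finset.range_eq_Ico, Finset.sum_Ico_add' F 0 M 1]
  rfl

lemma intervalAvg_succ (M : ℕ) (f : ℝ → ℝ) (p : ℕ) :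
    intervalAvg M f (p + 1) = M * ∫ x in ((p : ℝ) / M)..((p + 1 : ℕ) / M : ℝ), f x := by
  simp [intervalAvg]

lemma natCast_div_mem_Icc {M p : ℕ} (h : p ≤ M) : (p / M : ℝ) ∈ Icc (0 : ℝ) 1 :=
  ⟨by positivity, div_le_one_of_le₀ (by exact_mod_cast h) (by positivity)⟩

/-- The quadrature error of the group means of a function with derivative bounded by `Q`. -/
lemma abs_groupMean_sub_intervalAvg_le {M N : ℕ} (hM : 0 < M) (hN : 0 < N) {y : ℝ → ℝ} {Q : ℝ}
    (hy : DifferentiableOn ℝ y (Icc 0 1))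
    (hQ : ∀ x ∈ Icc (0:ℝ) 1, |derivWithin y (Icc 0 1) x| ≤ Q) {p : ℕ} (hp : p < M) :
    |groupMean M N y (p + 1) - intervalAvg M y (p + 1)| ≤ Q / (M * N) := by
  have hM' : (0 : ℝ) < M := by exact_mod_cast hM
  have hN' : (0 : ℝ) < N := by exact_mod_cast hN
  have hQ0 : 0 ≤ Q := (abs_nonneg _).trans (hQ 0 (by simp))
  set w : ℝ := 1 / (M * N) with hw
  have hw0 : 0 < w := by positivity
  have hlip : ∀ x ∈ Icc (0:ℝ) 1, ∀ z ∈ Icc (0:ℝ) 1, |y z - y x| ≤ Q * |z - x| := fun x hx z hz =>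
    (convex_Icc (0:ℝ) 1).norm_image_sub_le_of_norm_derivWithin_le hy hQ hx hz
  let u : ℕ → ℝ := fun j => (j : ℝ) / (M * N)
  have hu : ∀ j, u (j + 1) = u j + w := fun j => by simp only [u, hw]; push_cast; ring
  have hu01 : ∀ j, j ≤ (p + 1) * N → u j ∈ Icc (0:ℝ) 1 := fun j hj => by
    have := natCast_div_mem_Icc (M := M * N) (hj.trans (Nat.mul_le_mul_right N hp))
    push_cast at this
    exact this
  have hsub : ∀ j, j < (p + 1) * N → uIcc (u j) (u (j + 1)) ⊆ Icc 0 1 := fun j hj => by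
    rw [uIcc_of_le (by rw [hu]; linarith)]
    exact Icc_subset_Icc (hu01 j hj.le).1 (hu01 (j + 1) hj).2
  have hint : ∀ j, j < (p + 1) * N → IntervalIntegrable y volume (u j) (u (j + 1)) :=
    fun j hj => (hy.continuousOn.mono (hsub j hj)).intervalIntegrable
  have hle : p * N ≤ (p + 1) * N := Nat.mul_le_mul_right N p.le_succ
  have havg : intervalAvg M y (p + 1)
      = M * ∑ j ∈ Finset.Ico (p * N) ((p + 1) * N), ∫ x in (u j)..(u (j + 1)), y x := by
    rw [sum_integral_adjacent_intervals_Ico hle fun j hj => hint j hj.2, intervalAvg_succ]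
    congr 2
    · simp only [u]; push_cast; field_simp
    · simp only [u]; push_cast; field_simp
  have hgrp : groupMean M N y (p + 1)
      = M * ∑ j ∈ Finset.Ico (p * N) ((p + 1) * N), w * y (u (j + 1)) := by
    rw [← Finset.mul_sum, Finset.sum_Ico_add' (fun j => y (u j))]
    have : (M : ℝ) * w = 1 / N := by rw [hw]; field_simp
    rw [← mul_assoc, this]
    rfl
  have hcell : ∀ j ∈ Finset.Ico (p * N) ((p + 1) * N),
      |w * y (u (j + 1)) - ∫ x in (u j)..(u (j + 1)), y x| ≤ Q * w * w := by
    intro j hj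
    have hj2 := (Finset.mem_Ico.1 hj).2
    have hlen : u (j + 1) - u j = w := by rw [hu]; ring
    have : w * y (u (j + 1)) - ∫ x in (u j)..(u (j + 1)), y x
        = ∫ x in (u j)..(u (j + 1)), (y (u (j + 1)) - y x) := by
      rw [integral_sub intervalIntegrable_const (hint j hj2), intervalIntegral.integral_const,
        hlen, smul_eq_mul]
    rw [this]
    have hb := norm_integral_le_of_norm_le_const (a := u j) (b := u (j + 1)) (C := Q * w)
      (f := fun x => y (u (j + 1)) - y x) fun x hx => by
        have hx01 := hsub j hj2 (uIoc_subset_uIcc hx)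
        rw [uIoc_of_le (by rw [hu]; linarith)] at hx
        refine (hlip x hx01 _ (hu01 _ hj2)).trans ?_
        gcongr
        rw [abs_of_nonneg (by linarith [hx.2])]
        linarith [hx.1]
    rwa [hlen, abs_of_pos hw0] at hb
  rw [hgrp, havg, ← mul_sub, ← Finset.sum_sub_distrib, abs_mul, abs_of_pos hM']
  calc _ ≤ (M : ℝ) * ∑ j ∈ Finset.Ico (p * N) ((p + 1) * N), Q * w * w := by
        gcongr
        exact (Finset.abs_sum_le_sum_abs _ _).trans (Finset.sum_le_sum hcell)
    _ = Q / (M * N) := by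
        have hcard : (p + 1) * N - p * N = N := by rw [add_mul, one_mul]; omega
        rw [Finset.sum_const, Nat.card_Ico, hcard, nsmul_eq_mul, hw]
        field_simp

/-- The data misfit of the exact function is controlled by `Δ_M²` and the quadrature error. -/
lemma misfit_le_deltaSq {M N : ℕ} (hM : 0 < M) (hN : 0 < N) {y : ℝ → ℝ} {Q : ℝ} (Ytil : ℕ → ℝ)
    (hy : DifferentiableOn ℝ y (Icc 0 1))
    (hQ : ∀ x ∈ Icc (0:ℝ) 1, |derivWithin y (Icc 0 1) x| ≤ Q) :
    (1 / M : ℝ) * ∑ i ∈ Finset.Icc 1 M, (Ytil i - intervalAvg M y i) ^ 2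
      ≤ 2 * deltaSq M N Ytil y + 2 * (Q / (M * N)) ^ 2 := by
  have hM' : (0 : ℝ) < M := by exact_mod_cast hM
  have hterm : ∀ i ∈ Finset.Icc 1 M, (Ytil i - intervalAvg M y i) ^ 2
      ≤ 2 * (Ytil i - groupMean M N y i) ^ 2 + 2 * (Q / (M * N)) ^ 2 := by
    intro i hi
    rw [Finset.mem_Icc] at hi
    obtain ⟨p, rfl⟩ := Nat.exists_eq_add_of_le' hi.1
    have hb := abs_le.1 (abs_groupMean_sub_intervalAvg_le hM hN hy hQ hi.2)
    have h := sq_le_sq' hb.1 hb.2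
    nlinarith [sq_nonneg ((Ytil (p + 1) - groupMean M N y (p + 1))
      - (groupMean M N y (p + 1) - intervalAvg M y (p + 1)))]
  calc _ ≤ (1 / M : ℝ) * ∑ i ∈ Finset.Icc 1 M,
        (2 * (Ytil i - groupMean M N y i) ^ 2 + 2 * (Q / (M * N)) ^ 2) := by
        gcongr with i hi
        exact hterm i hi
    _ = _ := by
        rw [Finset.sum_add_distrib, ← Finset.mul_sum, Finset.sum_const, Nat.card_Icc,
          Nat.add_sub_cancel, nsmul_eq_mul, deltaSq]
        field_simp

/-- The `L²` norm is controlled by the derivative and the cell averages. -/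
lemma l2norm_sq_le_deriv_add_intervalAvg {M : ℕ} (hM : 0 < M) {e : ℝ → ℝ}
    (he : ContDiffOn ℝ 1 e (Icc 0 1)) :
    l2norm e ^ 2 ≤ ((1 / M : ℝ) * l2norm (derivWithin e (Icc 0 1))) ^ 2
      + (1 / M : ℝ) * ∑ i ∈ Finset.Icc 1 M, intervalAvg M e i ^ 2 := by
  have hM' : (0 : ℝ) < M := by exact_mod_cast hM
  let u : ℕ → ℝ := fun j => (j : ℝ) / M
  have hlen : ∀ j, u (j + 1) - u j = 1 / M := fun j => by simp only [u]; push_cast; ring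
  have hlt : ∀ j, u j < u (j + 1) := fun j => by
    have : (0 : ℝ) < 1 / M := by positivity
    linarith [hlen j]
  have hu01 : ∀ j, j ≤ M → u j ∈ Icc (0:ℝ) 1 := fun j hj => natCast_div_mem_Icc hj
  have hsub : ∀ j, j < M → Icc (u j) (u (j + 1)) ⊆ Icc 0 1 := fun j hj =>
    Icc_subset_Icc (hu01 j hj.le).1 (hu01 (j + 1) hj).2
  have hd : ContinuousOn (derivWithin e (Icc 0 1)) (Icc 0 1) :=
    he.continuousOn_derivWithin (uniqueDiffOn_Icc zero_lt_one) le_rfl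
  have hsplit : ∀ g : ℝ → ℝ, ContinuousOn g (Icc 0 1) →
      l2norm g ^ 2 = ∑ j ∈ Finset.range M, ∫ x in (u j)..(u (j + 1)), g x ^ 2 := by
    intro g hg
    rw [l2norm_sq, sum_integral_adjacent_intervals fun j hj => by
      refine ContinuousOn.intervalIntegrable ?_
      rw [uIcc_of_le (hlt j).le]
      exact (hg.mono (hsub j hj)).pow 2]
    simp [u, hM'.ne']
  rw [mul_pow, hsplit e he.continuousOn, hsplit _ hd, sum_Icc_one_eq_sum_range, Finset.mul_sum,
    Finset.mul_sum, ← Finset.sum_add_distrib]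
  refine Finset.sum_le_sum fun j hj => ?_
  rw [Finset.mem_range] at hj
  have h := integral_sq_le_deriv_add_mean (hlt j) (he.continuousOn.mono (hsub j hj))
    (hd.mono (hsub j hj)) fun x hx => by
      have hx01 : Icc (0:ℝ) 1 ∈ nhds x :=
        Icc_mem_nhds ((hu01 j hj.le).1.trans_lt hx.1) (hx.2.trans_le (hu01 (j + 1) hj).2)
      exact ((he.differentiableOn one_ne_zero x (mem_of_mem_nhds hx01)).hasDerivWithinAt).hasDerivAt
        hx01
  rw [hlen] at h
  refine h.trans_eq ?_
  rw [intervalAvg_succ]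
  field_simp
  rfl

lemma intervalAvg_sub {M : ℕ} {f g : ℝ → ℝ} (hf : ContinuousOn f (Icc 0 1))
    (hg : ContinuousOn g (Icc 0 1)) {i : ℕ} (hi : i ∈ Finset.Icc 1 M) :
    intervalAvg M (fun x => f x - g x) i = intervalAvg M f i - intervalAvg M g i := by
  rw [Finset.mem_Icc] at hi
  obtain ⟨p, rfl⟩ := Nat.exists_eq_add_of_le' hi.1
  have hsub : uIcc ((p : ℝ) / M) ((p + 1 : ℕ) / M : ℝ) ⊆ Icc 0 1 :=
    uIcc_subset_Icc (natCast_div_mem_Icc (by omega)) (natCast_div_mem_Icc hi.2)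
  simp only [intervalAvg_succ]
  rw [integral_sub (hf.mono hsub).intervalIntegrable (hg.mono hsub).intervalIntegrable, mul_sub]

end

/-- With the parameter choice `α = c̄·σ²/N` and the high-probability bound
`Δ_M² ≤ z̄·σ²/N`, the error `e = f_* − y` satisfies
`‖e^{(k)}‖ ≤ sqrt(2z̄/c̄ + 2Q²h_M²/(c̄Nσ²)) + 2‖y^{(k)}‖` and
`‖e‖ ≤ h_M‖e'‖ + sqrt((8z̄σ² + 2c̄σ²‖y^{(k)}‖²)/N + 8Q²h_M²/N²)`. -/
theorem error_bounds_with_parameter_choice (k M N : ℕ) (hk : 2 ≤ k) (hM : 2 ≤ M)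
    (hN : 1 ≤ N) (σ cbar zbar : ℝ) (hσ : 0 < σ) (hc : 0 < cbar) (hz : 0 < zbar)
    (α : ℝ) (hα : α = cbar * σ ^ 2 / N)
    (Ytil : ℕ → ℝ) (Q : ℝ) (y fstar : ℝ → ℝ)
    (hy : ContDiffOn ℝ k y (Icc 0 1))
    (hQ : ∀ x ∈ Icc (0:ℝ) 1, |derivWithin y (Icc 0 1) x| ≤ Q)
    (hdelta : deltaSq M N Ytil y ≤ zbar * σ ^ 2 / N)
    (hf : ContDiffOn ℝ k fstar (Icc 0 1))
    (hb0 : fstar 0 = y 0) (hb1 : fstar 1 = y 1)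
    (hmin : tikhonov M k α Ytil fstar ≤ tikhonov M k α Ytil y) :
    l2norm (iteratedDerivWithin k (fun x => fstar x - y x) (Icc 0 1))
      ≤ Real.sqrt (2 * zbar / cbar
          + 2 * Q ^ 2 * (1 / M : ℝ) ^ 2 / (cbar * N * σ ^ 2))
        + 2 * l2norm (iteratedDerivWithin k y (Icc 0 1)) ∧
    l2norm (fun x => fstar x - y x)
      ≤ (1 / M : ℝ) * l2norm (derivWithin (fun x => fstar x - y x) (Icc 0 1))
        + Real.sqrt ((8 * zbar * σ ^ 2
              + 2 * cbar * σ ^ 2 * l2norm (iteratedDerivWithin k y (Icc 0 1)) ^ 2) / N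
            + 8 * Q ^ 2 * (1 / M : ℝ) ^ 2 / N ^ 2) := by
  have hM0 : 0 < M := by omega
  have hM' : (0 : ℝ) < M := by exact_mod_cast hM0
  have hN' : (0 : ℝ) < N := by exact_mod_cast hN
  have hα0 : 0 < α := by rw [hα]; positivity
  have hU : UniqueDiffOn ℝ (Icc (0:ℝ) 1) := uniqueDiffOn_Icc zero_lt_one
  have hk1 : (1 : WithTop ℕ∞) ≤ k := by exact_mod_cast (by omega : 1 ≤ k)
  have hyk := hy.continuousOn_iteratedDerivWithin le_rfl hU
  have hfk := hf.continuousOn_iteratedDerivWithin le_rfl hU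
  have hmis := misfit_le_deltaSq hM0 hN Ytil ((hy.of_le hk1).differentiableOn one_ne_zero) hQ
  simp only [tikhonov, ← l2norm_sq] at hmin
  set A := l2norm (iteratedDerivWithin k y (Icc 0 1))
  set F := l2norm (iteratedDerivWithin k fstar (Icc 0 1))
  set Sy := (1 / M : ℝ) * ∑ i ∈ Finset.Icc 1 M, (Ytil i - intervalAvg M y i) ^ 2
  set Sf := (1 / M : ℝ) * ∑ i ∈ Finset.Icc 1 M, (Ytil i - intervalAvg M fstar i) ^ 2
  have hSf0 : 0 ≤ Sf := by positivity
  have hA : 0 ≤ A := l2norm_nonneg _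
  have hF : 0 ≤ F := l2norm_nonneg _
  have hSy : Sy ≤ 2 * (zbar * σ ^ 2 / N) + 2 * (Q / (M * N)) ^ 2 := by linarith
  constructor
  · have hsub : l2norm (iteratedDerivWithin k (fun x => fstar x - y x) (Icc 0 1)) ≤ F + A := by
      refine (l2norm_congr fun x hx => ?_).trans_le (l2norm_sub_le hfk hyk)
      exact iteratedDerivWithin_sub hx hU (hf x hx) (hy x hx)
    set R := 2 * zbar / cbar + 2 * Q ^ 2 * (1 / M : ℝ) ^ 2 / (cbar * N * σ ^ 2)
    have hR : 0 ≤ R := by positivity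
    have hαR : α * R = 2 * (zbar * σ ^ 2 / N) + 2 * (Q / (M * N)) ^ 2 := by
      simp only [hα, R]; field_simp
    have hF2 : F ^ 2 ≤ R + A ^ 2 := by
      refine le_of_mul_le_mul_left ?_ hα0
      rw [mul_add]
      linarith
    have hFle : F ≤ √R + A := by
      refine (abs_le_of_sq_le_sq' ?_ (by positivity)).2
      nlinarith [Real.sq_sqrt hR, mul_nonneg (Real.sqrt_nonneg R) hA]
    linarith
  · have hmean : (1 / M : ℝ) * ∑ i ∈ Finset.Icc 1 M, intervalAvg M (fun x => fstar x - y x) i ^ 2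
        ≤ 2 * Sy + 2 * Sf := by
      have : 2 * Sy + 2 * Sf = (1 / M : ℝ) * ∑ i ∈ Finset.Icc 1 M,
          (2 * (Ytil i - intervalAvg M y i) ^ 2 + 2 * (Ytil i - intervalAvg M fstar i) ^ 2) := by
        rw [Finset.sum_add_distrib, ← Finset.mul_sum, ← Finset.mul_sum]
        ring
      rw [this]
      gcongr with i hi
      rw [intervalAvg_sub hf.continuousOn hy.continuousOn hi]
      nlinarith [sq_nonneg ((Ytil i - intervalAvg M y i) + (Ytil i - intervalAvg M fstar i))]
    have hP := l2norm_sq_le_deriv_add_intervalAvg hM0 ((hf.of_le hk1).sub (hy.of_le hk1))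
    set D := (1 / M : ℝ) * l2norm (derivWithin (fun x => fstar x - y x) (Icc 0 1))
    have hD : 0 ≤ D := mul_nonneg (by positivity) (l2norm_nonneg _)
    set B := (8 * zbar * σ ^ 2 + 2 * cbar * σ ^ 2 * A ^ 2) / N
      + 8 * Q ^ 2 * (1 / M : ℝ) ^ 2 / N ^ 2 with hB
    have hB0 : 0 ≤ B := by positivity
    have hBeq : B = 4 * (2 * (zbar * σ ^ 2 / N) + 2 * (Q / (M * N)) ^ 2) + 2 * (α * A ^ 2) := by
      rw [hB, hα]; field_simp; ring
    refine (abs_le_of_sq_le_sq' ?_ (by positivity)).2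
    have hαF : 0 ≤ α * F ^ 2 := by positivity
    have hBd : l2norm (fun x => fstar x - y x) ^ 2 ≤ D ^ 2 + B := by
      refine hP.trans ?_
      gcongr
      linarith
    nlinarith [Real.sq_sqrt hB0, mul_nonneg (Real.sqrt_nonneg B) hD]
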